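/- Let N ≥ 1 be an integer, p ∈ (1,∞), s ∈ (0,1), Λ > 0, and let K : ℝ^N ∖ {0} → (0,∞) be measurable with K(-z) = K(z) and K(z) ≤ Λ |z|^{-(N+sp)} for all z ≠ 0. Let Ω ⊆ ℝ^N be open, I ⊂ ℝ a bounded interval, V open, 𝒦 compact and U open with V ⊆ 𝒦 ⊆ U and closure(U) compact and contained in Ω, and let ρ > 0 satisfy B_ρ(x) ⊆ U for every x ∈ 𝒦. Let φ ∈ C²_x ∩ C¹_t(U × I) with φ, ∇_x φ, D²_x φ and ∂_t φ bounded on U × I, with m := inf_{U × I} |∇_x φ| > 0, and suppose there is δ > 0 such that for every (x,t) ∈ V × I the principal value L_K^{B_ρ} φ(x,t) exists and ∂_t φ(x,t) + L_K^{B_ρ} φ(x,t) ≥ δ. Let η ∈ C²_x ∩ C¹_t with compact support contained in V × I and 0 ≤ η ≤ 1. Then there exists ε₀ ∈ (0,1) such that for every 0 < ε < ε₀ and every (x,t) ∈ V × I, the principal value L_K^{B_ρ}(φ - εη)(x,t) exists and ∂_t(φ - εη)(x,t) + L_K^{B_ρ}(φ - εη)(x,t) ≥ δ/2. -/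

import Mathlib

open MeasureTheory Set Metric Filter
open scoped ENNReal NNReal Topology Classical

noncomputable section

abbrev Euc (N : ℕ) := EuclideanSpace ℝ (Fin N)

/-- `J_p(t) = |t|^{p-2} t`. -/
def Jp (p t : ℝ) : ℝ := |t| ^ (p - 2) * t

/-- A symmetric kernel comparable to the fractional `p`-Laplace kernel. -/
def IsKernel (N : ℕ) (p s lam Lam : ℝ) (K : Euc N → ℝ) : Prop :=
  Measurable K ∧
  (∀ z : Euc N, z ≠ 0 → 0 < K z) ∧
  (∀ z : Euc N, z ≠ 0 → K (-z) = K z) ∧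
  (∀ z : Euc N, z ≠ 0 →
    lam * ‖z‖ ^ (-((N : ℝ) + s * p)) ≤ K z ∧ K z ≤ Lam * ‖z‖ ^ (-((N : ℝ) + s * p)))

/-- Local weak solution of `∂ₜ u + L_K u = 0` in `Ω × I`. -/
def IsLocalWeakSolution (N : ℕ) (p s : ℝ) (K : Euc N → ℝ)
    (Ω : Set (Euc N)) (I : Set ℝ) (u : Euc N → ℝ → ℝ) : Prop :=
  (∀ J : Set ℝ, IsCompact J → J ⊆ interior I →
    ∀ U : Set (Euc N), IsOpen U → IsCompact (closure U) → closure U ⊆ Ω →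
      (∫⁻ t in J, ∫⁻ x in U, ∫⁻ y in U,
          ENNReal.ofReal (|u x t - u y t| ^ p * ‖x - y‖ ^ (-((N : ℝ) + s * p)))) < ⊤ ∧
      (∫⁻ t in J, ∫⁻ x in U, ENNReal.ofReal (|u x t| ^ p)) < ⊤ ∧
      essSup (fun t => ∫⁻ x, ENNReal.ofReal (|u x t| ^ (p - 1) / (1 + ‖x‖ ^ ((N : ℝ) + s * p))))
        (volume.restrict J) < ⊤ ∧
      (∀ t₀ ∈ I, Tendsto (fun t => ∫ x in U, (u x t - u x t₀) ^ 2)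
          (nhdsWithin t₀ I) (nhds 0))) ∧
  (∀ φ : Euc N × ℝ → ℝ, ContDiff ℝ (⊤ : ℕ∞) φ → HasCompactSupport φ →
    tsupport φ ⊆ Ω ×ˢ interior I →
    -(∫ t in I, ∫ x in Ω, u x t * deriv (fun τ => φ (x, τ)) t) +
      (1 / 2) * ∫ t in I, ∫ x, ∫ y,
        Jp p (u x t - u y t) * (φ (x, t) - φ (y, t)) * K (x - y) = 0)

/-- Essential supremum of `|u|` over a space-time set. -/
def supAbs (N : ℕ) (u : Euc N → ℝ → ℝ) (Q : Set (Euc N × ℝ)) : ℝ≥0∞ :=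
  essSup (fun q : Euc N × ℝ => ENNReal.ofReal |u q.1 q.2|) (volume.restrict Q)

/-- The nonlocal tail `Tail(w; x₀, r)`. -/
def tailFn (N : ℕ) (p s : ℝ) (w : Euc N → ℝ) (x₀ : Euc N) (r : ℝ) : ℝ :=
  (r ^ (s * p) *
    ∫ x in (ball x₀ r)ᶜ, |w x| ^ (p - 1) * ‖x - x₀‖ ^ (-((N : ℝ) + s * p))) ^ (1 / (p - 1))

/-- The parabolic tail `Tail_∞(u; x₀, r, J)`. -/
def tailSup (N : ℕ) (p s : ℝ) (u : Euc N → ℝ → ℝ) (x₀ : Euc N) (r : ℝ) (J : Set ℝ) : ℝ≥0∞ :=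
  essSup (fun t => ENNReal.ofReal (tailFn N p s (fun x => u x t) x₀ r)) (volume.restrict J)

/-- `M_R = ‖u‖_{L^∞(Q_{2R,2R^{sp}}(x₀,t₀))} + Tail_∞(u; x₀, R, (t₀-2R^{sp},t₀]) + 1`. -/
def MR (N : ℕ) (p s : ℝ) (u : Euc N → ℝ → ℝ) (x₀ : Euc N) (R t₀ : ℝ) : ℝ≥0∞ :=
  supAbs N u (ball x₀ (2 * R) ×ˢ Ioc (t₀ - 2 * R ^ (s * p)) t₀)
    + tailSup N p s u x₀ R (Ioc (t₀ - 2 * R ^ (s * p)) t₀) + 1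

/-- `φ ∈ C²ₓ ∩ C¹ₜ(U × I)` with derivative data `Dφ, D2φ, φt`. -/
def C2xC1t (N : ℕ) (U : Set (Euc N)) (I : Set ℝ) (φ : Euc N → ℝ → ℝ)
    (Dφ : Euc N → ℝ → (Euc N →L[ℝ] ℝ)) (D2φ : Euc N → ℝ → (Euc N →L[ℝ] Euc N →L[ℝ] ℝ))
    (φt : Euc N → ℝ → ℝ) : Prop :=
  ContinuousOn (fun q : Euc N × ℝ => φ q.1 q.2) (U ×ˢ I) ∧
  (∀ x ∈ U, ∀ t ∈ I, HasFDerivAt (fun y => φ y t) (Dφ x t) x) ∧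
  ContinuousOn (fun q : Euc N × ℝ => Dφ q.1 q.2) (U ×ˢ I) ∧
  (∀ x ∈ U, ∀ t ∈ I, HasFDerivAt (fun y => Dφ y t) (D2φ x t) x) ∧
  ContinuousOn (fun q : Euc N × ℝ => D2φ q.1 q.2) (U ×ˢ I) ∧
  (∀ x ∈ U, ∀ t ∈ I, HasDerivWithinAt (fun τ => φ x τ) (φt x t) I t) ∧
  ContinuousOn (fun q : Euc N × ℝ => φt q.1 q.2) (U ×ˢ I)

/-- The truncated integral over the annulus `δ < |x - y| < ρ`. -/
def pvIntegral (N : ℕ) (p ρ : ℝ) (K : Euc N → ℝ) (w : Euc N → ℝ) (x : Euc N) (δ : ℝ) : ℝ :=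
  ∫ y in {y : Euc N | δ < dist y x ∧ dist y x < ρ}, Jp p (w x - w y) * K (x - y)

/-- Existence of the principal value `L_K^{B_ρ} w (x) = l`. -/
def HasPV (N : ℕ) (p ρ : ℝ) (K : Euc N → ℝ) (w : Euc N → ℝ) (x : Euc N) (l : ℝ) : Prop :=
  Tendsto (fun δ => pvIntegral N p ρ K w x δ) (nhdsWithin 0 (Ioi 0)) (nhds l)

/-- Weak supersolution of `∂ₜ w + L_K^{B_ρ} w = f` in `U × I`. -/
def IsTruncSuper (N : ℕ) (p ρ : ℝ) (K : Euc N → ℝ) (U : Set (Euc N)) (I : Set ℝ)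
    (f w : Euc N → ℝ → ℝ) : Prop :=
  ∀ φ : Euc N × ℝ → ℝ, ContDiff ℝ (⊤ : ℕ∞) φ → HasCompactSupport φ →
    tsupport φ ⊆ U ×ˢ interior I → (∀ q, 0 ≤ φ q) →
    ∫ t in I, ∫ x in U, f x t * φ (x, t) ≤
      -(∫ t in I, ∫ x in U, w x t * deriv (fun τ => φ (x, τ)) t) +
        (1 / 2) * ∫ t in I, ∫ q in {q : Euc N × Euc N | dist q.1 q.2 < ρ},
          Jp p (w q.1 t - w q.2 t) * (φ (q.1, t) - φ (q.2, t)) * K (q.1 - q.2)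

/-- Weak subsolution of `∂ₜ w + L_K^{B_ρ} w = f` in `U × I`. -/
def IsTruncSub (N : ℕ) (p ρ : ℝ) (K : Euc N → ℝ) (U : Set (Euc N)) (I : Set ℝ)
    (f w : Euc N → ℝ → ℝ) : Prop :=
  ∀ φ : Euc N × ℝ → ℝ, ContDiff ℝ (⊤ : ℕ∞) φ → HasCompactSupport φ →
    tsupport φ ⊆ U ×ˢ interior I → (∀ q, 0 ≤ φ q) →
    -(∫ t in I, ∫ x in U, w x t * deriv (fun τ => φ (x, τ)) t) +
        (1 / 2) * ∫ t in I, ∫ q in {q : Euc N × Euc N | dist q.1 q.2 < ρ},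
          Jp p (w q.1 t - w q.2 t) * (φ (q.1, t) - φ (q.2, t)) * K (q.1 - q.2) ≤
      ∫ t in I, ∫ x in U, f x t * φ (x, t)

theorem Jp_eq (p t : ℝ) (hp : 1 < p) : Jp p t = (max t 0) ^ (p - 1) - (max (-t) 0) ^ (p - 1) := by
  unfold Jp
  have h0 : (0 : ℝ) ^ (p - 1) = 0 := Real.zero_rpow (by linarith)
  have key : ∀ t : ℝ, 0 < t → t ^ (p - 2) * t = t ^ (p - 1) := by
    intro t ht
    rw [← Real.rpow_add_one ht.ne']
    congr 1; ring
  rcases lt_trichotomy t 0 with h | h | h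
  · rw [abs_of_neg h, max_eq_right h.le, max_eq_left (by linarith), h0, ← key (-t) (by linarith)]
    ring
  · subst h; simp
  · rw [abs_of_pos h, max_eq_left h.le, max_eq_right (by linarith), h0, key t h]
    ring

theorem Jp_cont (p : ℝ) (hp : 1 < p) : Continuous (Jp p) := by
  have : Jp p = fun t => (max t 0) ^ (p - 1) - (max (-t) 0) ^ (p - 1) := by
    funext t; exact Jp_eq p t hp
  rw [this]
  refine Continuous.sub ?_ ?_
  · exact (continuous_id.max continuous_const).rpow_const (fun _ => Or.inr (by linarith))
  · exact (continuous_id.neg.max continuous_const).rpow_const (fun _ => Or.inr (by linarith))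

theorem Jp_neg (p t : ℝ) : Jp p (-t) = - Jp p t := by
  unfold Jp; rw [abs_neg]; ring

theorem Jp_abs_le (p t R : ℝ) (hp : 1 < p) (h : |t| ≤ R) : |Jp p t| ≤ R ^ (p - 1) := by
  have : |Jp p t| = |t| ^ (p - 1) := by
    unfold Jp
    rw [abs_mul, abs_of_nonneg (by positivity : (0:ℝ) ≤ |t| ^ (p-2))]
    rcases eq_or_ne t 0 with h | h
    · subst h; simp; rw [Real.zero_rpow (by linarith)]
    · rw [← Real.rpow_add_one (abs_ne_zero.2 h)]
      congr 1; ring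
  rw [this]
  exact Real.rpow_le_rpow (abs_nonneg _) h (by linarith)

theorem rpow_lip (k M a b : ℝ) (hk : 1 ≤ k) (ha : a ∈ Icc 0 M) (hb : b ∈ Icc 0 M) :
    |a ^ k - b ^ k| ≤ k * M ^ (k - 1) * |a - b| := by
  have := (convex_Icc (0:ℝ) M).norm_image_sub_le_of_norm_hasDerivWithin_le
    (f := fun x => x ^ k) (f' := fun x => k * x ^ (k - 1)) (C := k * M ^ (k - 1))
    (fun x hx => (Real.hasDerivAt_rpow_const (Or.inr hk)).hasDerivWithinAt)
    (fun x hx => by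
      rw [Real.norm_eq_abs, abs_of_nonneg (mul_nonneg (by linarith) (Real.rpow_nonneg hx.1 _))]
      exact mul_le_mul_of_nonneg_left (Real.rpow_le_rpow hx.1 hx.2 (by linarith)) (by linarith))
    hb ha
  simpa [Real.norm_eq_abs] using this

theorem Jp_lip_ge (p M a b : ℝ) (hp : 2 ≤ p) (ha : |a| ≤ M) (hb : |b| ≤ M) :
    |Jp p a - Jp p b| ≤ 2 * (p - 1) * M ^ (p - 2) * |a - b| := by
  have hM : 0 ≤ M := (abs_nonneg a).trans ha
  rw [abs_le] at ha hb
  rw [Jp_eq p a (by linarith), Jp_eq p b (by linarith)]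
  have h1 := rpow_lip (p - 1) M (max a 0) (max b 0) (by linarith)
    ⟨le_max_right _ _, max_le ha.2 hM⟩ ⟨le_max_right _ _, max_le hb.2 hM⟩
  have h2 := rpow_lip (p - 1) M (max (-a) 0) (max (-b) 0) (by linarith)
    ⟨le_max_right _ _, max_le (by linarith) hM⟩ ⟨le_max_right _ _, max_le (by linarith) hM⟩
  have e : p - 1 - 1 = p - 2 := by ring
  rw [e] at h1 h2
  have h3 : |max a 0 - max b 0| ≤ |a - b| := abs_max_sub_max_le_abs a b 0
  have h4 : |max (-a) 0 - max (-b) 0| ≤ |a - b| := by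
    have := abs_max_sub_max_le_abs (-a) (-b) 0
    rwa [show -a - -b = -(a - b) by ring, abs_neg] at this
  have hc : 0 ≤ (p - 1) * M ^ (p - 2) := mul_nonneg (by linarith) (Real.rpow_nonneg hM _)
  have h5 := mul_le_mul_of_nonneg_left h3 hc
  have h6 := mul_le_mul_of_nonneg_left h4 hc
  calc _ = |((max a 0) ^ (p - 1) - (max b 0) ^ (p - 1)) -
        ((max (-a) 0) ^ (p - 1) - (max (-b) 0) ^ (p - 1))| := by congr 1; ring
    _ ≤ _ := abs_sub _ _
    _ ≤ _ := by linarith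

theorem Jp_lip_pos (p c a b : ℝ) (hp : 1 < p) (hp2 : p < 2) (hc : 0 < c) (ha : c ≤ a) (hb : c ≤ b) :
    |Jp p a - Jp p b| ≤ (p - 1) * c ^ (p - 2) * |a - b| := by
  have h0 : (0 : ℝ) ^ (p - 1) = 0 := Real.zero_rpow (by linarith)
  have := (convex_Ici c).norm_image_sub_le_of_norm_hasDerivWithin_le
    (f := fun x => x ^ (p - 1)) (f' := fun x => (p - 1) * x ^ (p - 1 - 1))
    (C := (p - 1) * c ^ (p - 2))
    (fun x hx => (Real.hasDerivAt_rpow_const (Or.inl (hc.trans_le hx).ne')).hasDerivWithinAt)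
    (fun x hx => by
      have hx' : 0 < x := hc.trans_le hx
      rw [Real.norm_eq_abs, abs_of_nonneg (mul_nonneg (by linarith) (Real.rpow_nonneg hx'.le _)),
        show p - 1 - 1 = p - 2 by ring]
      exact mul_le_mul_of_nonneg_left (Real.rpow_le_rpow_of_nonpos hc hx (by linarith))
        (by linarith))
    hb ha
  rw [Jp_eq p a hp, Jp_eq p b hp, max_eq_left (by linarith : 0 ≤ a),
    max_eq_left (by linarith : 0 ≤ b), max_eq_right (by linarith : -a ≤ 0),
    max_eq_right (by linarith : -b ≤ 0), h0]
  simpa [Real.norm_eq_abs] using this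

/-- case `p < 2`. -/
theorem Jp_diff_lt (p a b u d : ℝ) (hp : 1 < p) (hp2 : p < 2) (hd : 0 < d) (hu : u ≠ 0)
    (ha : |a - u| ≤ d) (hb : |b - u| ≤ d) :
    |Jp p a - Jp p b| ≤ 36 * d * |u| ^ (p - 2) := by
  wlog hpos : 0 < u generalizing a b u
  · have := this (-a) (-b) (-u) (neg_ne_zero.2 hu)
      (by rw [show -a - -u = -(a - u) by ring, abs_neg]; exact ha)
      (by rw [show -b - -u = -(b - u) by ring, abs_neg]; exact hb)
      (by
        have := lt_of_le_of_ne (not_lt.1 hpos) hu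
        linarith)
    rw [Jp_neg, Jp_neg, abs_neg, show -Jp p a - -Jp p b = -(Jp p a - Jp p b) by ring,
      abs_neg] at this
    exact this
  rw [abs_of_pos hpos]
  have hab : |a - b| ≤ 2 * d := by
    calc |a - b| = |(a - u) - (b - u)| := by congr 1; ring
      _ ≤ _ := abs_sub _ _
      _ ≤ _ := by linarith
  rw [abs_le] at ha hb
  have hup : 0 < u ^ (p - 2) := Real.rpow_pos_of_pos hpos _
  have h2 : (1 / 2 : ℝ) ^ (p - 2) ≤ 2 := by
    calc (1 / 2 : ℝ) ^ (p - 2) ≤ (1 / 2 : ℝ) ^ (-1 : ℝ) :=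
          Real.rpow_le_rpow_of_exponent_ge (by norm_num) (by norm_num) (by linarith)
      _ = 2 := by rw [Real.rpow_neg_one]; norm_num
  rcases le_or_gt (2 * d) u with h | h
  · have := Jp_lip_pos p (u / 2) a b hp hp2 (by linarith) (by linarith) (by linarith)
    have e : (u / 2) ^ (p - 2) = (1 / 2) ^ (p - 2) * u ^ (p - 2) := by
      rw [← Real.mul_rpow (by norm_num) hpos.le]; congr 1; ring
    rw [e] at this
    calc _ ≤ _ := this
      _ ≤ 1 * (2 * u ^ (p - 2)) * (2 * d) := by gcongr; linarith
      _ ≤ _ := by nlinarith [mul_pos hd hup]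
  · have h3 : |a| ≤ 3 * d := abs_le.2 ⟨by linarith, by linarith⟩
    have h4 : |b| ≤ 3 * d := abs_le.2 ⟨by linarith, by linarith⟩
    have h5 := Jp_abs_le p a _ hp h3
    have h6 := Jp_abs_le p b _ hp h4
    have h7 : (3 * d) ^ (p - 1) = (3 * d) ^ (p - 2) * (3 * d) := by
      rw [← Real.rpow_add_one (by positivity)]; congr 1; ring
    have h8 : (3 * d) ^ (p - 2) ≤ u ^ (p - 2) :=
      Real.rpow_le_rpow_of_nonpos hpos (by linarith) (by linarith)
    have h9 : (3 * d) ^ (p - 2) * (3 * d) ≤ u ^ (p - 2) * (3 * d) :=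
      mul_le_mul_of_nonneg_right h8 (by positivity)
    calc _ ≤ |Jp p a| + |Jp p b| := abs_sub _ _
      _ ≤ 2 * (u ^ (p - 2) * (3 * d)) := by linarith
      _ ≤ _ := by nlinarith [mul_pos hd hup]

theorem Jp_diff (p B : ℝ) (hp : 1 < p) (hB : 0 < B) : ∃ C : ℝ, 0 ≤ C ∧
    ∀ a b u r : ℝ, 0 < r → r ≤ 1 → u ≠ 0 → |a - u| ≤ B * r ^ 2 → |b - u| ≤ B * r ^ 2 →
      |u| ≤ B * r → |Jp p a - Jp p b| ≤ C * (r ^ (2 + p - min p 2) * |u| ^ (min p 2 - 2)) := by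
  rcases lt_or_ge p 2 with h2 | h2
  · refine ⟨36 * B, by positivity, ?_⟩
    intro a b u r hr hr1 hu ha hb hur
    rw [min_eq_left h2.le, show 2 + p - p = (2 : ℕ) by push_cast; ring, Real.rpow_natCast]
    have := Jp_diff_lt p a b u (B * r ^ 2) hp h2 (by positivity) hu ha hb
    calc _ ≤ _ := this
      _ = _ := by ring
  · refine ⟨2 * (p - 1) * (2 * B) ^ (p - 2) * (2 * B), ?_, ?_⟩
    · have : 0 ≤ p - 1 := by linarith
      positivity
    intro a b u r hr hr1 hu ha hb hur
    rw [min_eq_right h2, sub_self, Real.rpow_zero, mul_one, show 2 + p - 2 = p by ring]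
    have hrr : B * r ^ 2 ≤ B * r := by
      apply mul_le_mul_of_nonneg_left _ hB.le
      nlinarith
    have hab : |a - b| ≤ 2 * B * r ^ 2 := by
      calc |a - b| = |(a - u) - (b - u)| := by congr 1; ring
        _ ≤ _ := abs_sub _ _
        _ ≤ _ := by linarith
    have haM : |a| ≤ 2 * B * r := by
      calc |a| = |(a - u) + u| := by congr 1; ring
        _ ≤ _ := abs_add_le _ _
        _ ≤ _ := by linarith
    have hbM : |b| ≤ 2 * B * r := by
      calc |b| = |(b - u) + u| := by congr 1; ring
        _ ≤ _ := abs_add_le _ _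
        _ ≤ _ := by linarith
    have := Jp_lip_ge p (2 * B * r) a b h2 haM hbM
    have e : r ^ p = r ^ (p - 2) * r ^ 2 := by
      rw [← Real.rpow_natCast r 2, ← Real.rpow_add hr]; congr 1; push_cast; ring
    have hp1 : 0 ≤ p - 1 := by linarith
    calc _ ≤ _ := this
      _ ≤ 2 * (p - 1) * (2 * B * r) ^ (p - 2) * (2 * B * r ^ 2) := by gcongr
      _ = _ := by
        rw [Real.mul_rpow (by positivity) hr.le, e]; ring

theorem ae_inner_ne (N : ℕ) (v : Euc N) (hv : v ≠ 0) : ∀ᵐ z : Euc N, inner ℝ v z ≠ 0 := by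
  have h := Measure.addHaar_submodule (volume : Measure (Euc N)) (LinearMap.ker (innerSL ℝ v).toLinearMap) (by
    intro h
    rw [LinearMap.ker_eq_top] at h
    have : (innerSL ℝ v) v = 0 := by
      have := congrArg (fun f => f v) h
      simpa using this
    simp at this
    exact hv this)
  rw [ae_iff]
  convert h using 2
  ext z
  simp

theorem abs_rpow_integrable (c : ℝ) (hc : -1 < c) :
    Integrable ((Icc (-1:ℝ) 1).indicator (fun t => |t| ^ c)) := by
  rw [integrable_indicator_iff measurableSet_Icc, integrableOn_Icc_iff_integrableOn_Ioc,
    ← intervalIntegrable_iff_integrableOn_Ioc_of_le (by norm_num)]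
  have h1 : IntervalIntegrable (fun t : ℝ => |t| ^ c) volume 0 1 := by
    refine (intervalIntegral.intervalIntegrable_rpow' hc).congr ?_
    intro t ht
    rw [uIoc_of_le (by norm_num)] at ht
    simp [abs_of_pos ht.1]
  have h2 : IntervalIntegrable (fun t : ℝ => |t| ^ c) volume (-1) 0 := by
    rw [IntervalIntegrable.iff_comp_neg]
    simpa using h1.symm
  exact h2.trans h1

theorem g_integrable (N : ℕ) (i0 : Fin N) (q β : ℝ) (hq : 1 < q) (hq2 : q ≤ 2)
    (hβ : β < N + q - 2) :
    IntegrableOn (fun z : Euc N => ‖z‖ ^ (-β) * |z i0| ^ (q - 2)) (ball 0 1) := by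
  have hN : (1 : ℝ) ≤ N := by
    have : 0 < N := i0.pos
    exact_mod_cast this
  have hd : 0 < N + q - 2 := by linarith
  obtain ⟨θ, hθ0, hθ1, hθ⟩ : ∃ θ : ℝ, 0 ≤ θ ∧ θ < 1 ∧ β ≤ θ * (N + q - 2) :=
    ⟨max 0 (β / (N + q - 2)), le_max_left _ _,
      max_lt (by norm_num) ((div_lt_one hd).2 hβ), by
        rw [← div_le_iff₀ hd]; exact le_max_right _ _⟩
  let c : Fin N → ℝ := fun i => θ - if i = i0 then (2 - q) * θ else 0
  have hc0 : ∀ i, 0 ≤ c i := by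
    intro i
    simp only [c]
    split_ifs <;> nlinarith
  have hcs : ∑ i, c i = θ * (N + q - 2) := by
    simp only [c, Finset.sum_sub_distrib, Finset.sum_const, Finset.card_univ, Fintype.card_fin,
      Finset.sum_ite_eq', Finset.mem_univ, if_true, nsmul_eq_mul]
    ring
  let k : Fin N → ℝ := fun i => if i = i0 then q - 2 else 0
  have hck : ∀ i, -1 < -c i + k i := by
    intro i
    simp only [c, k]
    split_ifs <;> nlinarith
  have hprod : Integrable (fun z : Fin N → ℝ =>
      ∏ i, (Icc (-1:ℝ) 1).indicator (fun t => |t| ^ (-c i + k i)) (z i)) :=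
    Integrable.fintype_prod (f := fun i => (Icc (-1:ℝ) 1).indicator (fun t => |t| ^ (-c i + k i)))
      (fun i => abs_rpow_integrable _ (hck i))
  have hprod' : Integrable (fun z : Euc N =>
      ∏ i, (Icc (-1:ℝ) 1).indicator (fun t => |t| ^ (-c i + k i)) (z i)) :=
    (PiLp.volume_preserving_ofLp (Fin N)).integrable_comp_of_integrable hprod
  refine Integrable.mono' hprod'.integrableOn ?_ ?_
  · apply Measurable.aestronglyMeasurable
    fun_prop
  · have hae : ∀ᵐ z : Euc N, ∀ i, z i ≠ 0 := by
      rw [ae_all_iff]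
      intro i
      have := ae_inner_ne N (EuclideanSpace.single i (1:ℝ)) (by simp)
      filter_upwards [this] with z hz
      simpa [EuclideanSpace.inner_single_left] using hz
    rw [ae_restrict_iff' measurableSet_ball]
    filter_upwards [hae] with z hz hzb
    have hz1 : ‖z‖ < 1 := by simpa using hzb
    have hzi : ∀ i, |z i| ≤ ‖z‖ := fun i => by
      simpa using PiLp.norm_apply_le z i
    have hpos : ∀ i, 0 < |z i| := fun i => abs_pos.2 (hz i)
    have hz0 : 0 < ‖z‖ := (hpos i0).trans_le (hzi i0)
    rw [Real.norm_eq_abs, abs_of_nonneg (by positivity)]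
    have e1 : ∏ i, (Icc (-1:ℝ) 1).indicator (fun t => |t| ^ (-c i + k i)) (z i) =
        (∏ i, |z i| ^ (-c i)) * |z i0| ^ (q - 2) := by
      have : ∀ i, (Icc (-1:ℝ) 1).indicator (fun t => |t| ^ (-c i + k i)) (z i) =
          |z i| ^ (-c i) * (if i = i0 then |z i| ^ (q - 2) else 1) := by
        intro i
        rw [indicator_of_mem (by
          rw [mem_Icc, ← abs_le]; exact (hzi i).trans hz1.le), Real.rpow_add (hpos i)]
        simp only [k]
        split_ifs <;> simp
      simp_rw [this, Finset.prod_mul_distrib]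
      simp
    rw [e1]
    apply mul_le_mul_of_nonneg_right _ (by positivity)
    calc ‖z‖ ^ (-β) ≤ ‖z‖ ^ (∑ i, -c i) := by
          apply Real.rpow_le_rpow_of_exponent_ge hz0 hz1.le
          rw [Finset.sum_neg_distrib, hcs]; linarith
      _ = ∏ i, ‖z‖ ^ (-c i) := Real.rpow_sum_of_pos hz0 _ _
      _ ≤ _ := by
        apply Finset.prod_le_prod
        · intro i _; positivity
        · intro i _
          exact Real.rpow_le_rpow_of_nonpos (hpos i) (hzi i) (by linarith [hc0 i])

/-- the dominating function -/
def gfun (N : ℕ) (q β : ℝ) (e : Euc N) (z : Euc N) : ℝ := ‖z‖ ^ (-β) * |inner ℝ e z| ^ (q - 2)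

theorem gfun_rot (N : ℕ) (i0 : Fin N) (q β : ℝ) (e : Euc N) (he : ‖e‖ = 1) (r : ℝ)
    (hi : IntegrableOn (fun z : Euc N => ‖z‖ ^ (-β) * |z i0| ^ (q - 2)) (ball 0 r)) :
    IntegrableOn (gfun N q β e) (ball 0 r) ∧
    ∫ z in ball 0 r, gfun N q β e z = ∫ z in ball 0 r, ‖z‖ ^ (-β) * |(z : Euc N) i0| ^ (q - 2) := by
  let T : Euc N ≃ₗᵢ[ℝ] Euc N :=
    (Submodule.span ℝ {e - EuclideanSpace.single i0 (1:ℝ)})ᗮ.reflection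
  have hT : T e = EuclideanSpace.single i0 (1:ℝ) := Submodule.reflection_sub (by simp [he])
  have hTm : MeasurePreserving T := T.measurePreserving
  have hcomp : gfun N q β e = (fun z : Euc N => ‖z‖ ^ (-β) * |z i0| ^ (q - 2)) ∘ T := by
    funext z
    have : inner ℝ e z = (T z) i0 := by
      rw [← T.inner_map_map, hT]
      simp [EuclideanSpace.inner_single_left]
    simp [gfun, this]
  have hpre : ball (0 : Euc N) r = T ⁻¹' ball 0 r := by
    ext z; simp
  have hemb : MeasurableEmbedding T := T.toHomeomorph.measurableEmbedding
  rw [hcomp]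
  constructor
  · rw [hpre]
    exact (hTm.integrableOn_comp_preimage hemb).2 hi
  · conv_lhs => rw [hpre]
    exact hTm.setIntegral_preimage_emb hemb
      (fun z : Euc N => ‖z‖ ^ (-β) * |z i0| ^ (q - 2)) (ball 0 r)

theorem g_small (N : ℕ) (i0 : Fin N) (f : Euc N → ℝ) (hf : IntegrableOn f (ball 0 1)) (τ : ℝ)
    (hτ : 0 < τ) (r0 : ℝ) (hr0 : 0 < r0) :
    ∃ r, 0 < r ∧ r ≤ 1 ∧ r ≤ r0 ∧ ∫ z in ball 0 r, f z < τ := by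
  have : Nonempty (Fin N) := ⟨i0⟩
  have h := tendsto_setIntegral_of_antitone (μ := (volume : Measure (Euc N))) (f := f)
    (s := fun n : ℕ => ball (0 : Euc N) (1 / ((n : ℝ) + 1)))
    (fun n => measurableSet_ball)
    (by
      intro a b hab
      apply ball_subset_ball
      exact Nat.one_div_le_one_div hab)
    ⟨0, by simpa using hf⟩
  have hint : (⋂ n : ℕ, ball (0 : Euc N) (1 / ((n : ℝ) + 1))) = {0} := by
    ext z
    simp only [mem_iInter, mem_ball_zero_iff, mem_singleton_iff]
    constructor
    · intro hz
      by_contra hne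
      obtain ⟨n, hn⟩ := exists_nat_one_div_lt (norm_pos_iff.2 hne)
      exact absurd (hz n) (not_lt.2 hn.le)
    · rintro rfl n
      simp; positivity
  rw [hint] at h
  have hz : ∫ z in ({0} : Set (Euc N)), f z = 0 := by
    rw [Measure.restrict_eq_zero.2 (by simp)]; simp
  rw [hz] at h
  have h1 := h.eventually (gt_mem_nhds hτ)
  have h2 := (tendsto_one_div_add_atTop_nhds_zero_nat (𝕜 := ℝ)).eventually (gt_mem_nhds hr0)
  obtain ⟨n, hn1, hn2⟩ := (h1.and h2).exists
  refine ⟨1 / ((n:ℝ) + 1), by positivity, ?_, hn2.le, hn1⟩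
  rw [div_le_one (by positivity)]
  have : (0:ℝ) ≤ n := by positivity
  linarith

/-- symmetrised integrand -/
def Sfun (N : ℕ) (p : ℝ) (K w : Euc N → ℝ) (x z : Euc N) : ℝ :=
  (Jp p (w x - w (x + z)) + Jp p (w x - w (x - z))) / 2 * K z

/-- spatial regularity data at a point -/
structure Good (N : ℕ) (w : Euc N → ℝ) (D : Euc N → (Euc N →L[ℝ] ℝ))
    (D2 : Euc N → (Euc N →L[ℝ] Euc N →L[ℝ] ℝ)) (x : Euc N) (ρ B m : ℝ) : Prop where
  d1 : ∀ y ∈ ball x ρ, HasFDerivAt w (D y) y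
  d2 : ∀ y ∈ ball x ρ, HasFDerivAt D (D2 y) y
  bw : ∀ y ∈ ball x ρ, |w y| ≤ B
  bd : ∀ y ∈ ball x ρ, ‖D y‖ ≤ B
  bdd : ∀ y ∈ ball x ρ, ‖D2 y‖ ≤ B
  grad : m ≤ ‖D x‖

theorem Good.taylor {N : ℕ} {w : Euc N → ℝ} {D : Euc N → (Euc N →L[ℝ] ℝ)}
    {D2 : Euc N → (Euc N →L[ℝ] Euc N →L[ℝ] ℝ)} {x : Euc N} {ρ B m : ℝ}
    (h : Good N w D D2 x ρ B m) (hρ : 0 < ρ) (hB : 0 < B) (z : Euc N) (hz : ‖z‖ < ρ) :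
    |w (x + z) - w x - D x z| ≤ B * ‖z‖ ^ 2 := by
  have hx : x ∈ ball x ρ := mem_ball_self hρ
  have hsub : closedBall x ‖z‖ ⊆ ball x ρ := closedBall_subset_ball hz
  have h1 : ∀ y ∈ closedBall x ‖z‖, ‖D y - D x‖ ≤ B * ‖z‖ := by
    intro y hy
    have := (convex_ball x ρ).norm_image_sub_le_of_norm_hasFDerivWithin_le
      (f := D) (f' := D2) (C := B) (fun v hv => (h.d2 v hv).hasFDerivWithinAt) h.bdd hx (hsub hy)
    refine this.trans (mul_le_mul_of_nonneg_left ?_ hB.le)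
    rwa [mem_closedBall, dist_eq_norm] at hy
  have h2 := (convex_closedBall x ‖z‖).norm_image_sub_le_of_norm_hasFDerivWithin_le'
    (f := w) (f' := D) (φ := D x) (C := B * ‖z‖) (x := x) (y := x + z)
    (fun v hv => (h.d1 v (hsub hv)).hasFDerivWithinAt) h1
    (mem_closedBall_self (norm_nonneg _)) (by simp [dist_eq_norm])
  rw [add_sub_cancel_left, Real.norm_eq_abs] at h2
  calc _ ≤ _ := h2
    _ = _ := by ring

theorem S_near (N : ℕ) (p s Lam ρ B m : ℝ) (hp : 1 < p) (hLam : 0 < Lam) (hρ : 0 < ρ) (hB : 0 < B)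
    (hm : 0 < m) (K : Euc N → ℝ) (hKpos : ∀ z : Euc N, z ≠ 0 → 0 < K z)
    (hKub : ∀ z : Euc N, z ≠ 0 → K z ≤ Lam * ‖z‖ ^ (-((N : ℝ) + s * p))) :
    ∃ C : ℝ, 0 ≤ C ∧ ∀ w D D2 x, Good N w D D2 x ρ B m → ∃ e : Euc N, ‖e‖ = 1 ∧
      ∀ z : Euc N, ‖z‖ < ρ → ‖z‖ ≤ 1 → inner ℝ e z ≠ 0 →
        |Sfun N p K w x z| ≤ C * gfun N (min p 2) (N + s * p - (2 + p - min p 2)) e z := by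
  obtain ⟨C, hC0, hC⟩ := Jp_diff p B hp hB
  refine ⟨C * Lam * m ^ (min p 2 - 2), by positivity, ?_⟩
  intro w D D2 x h
  let v := (InnerProductSpace.toDual ℝ (Euc N)).symm (D x)
  have hvn : ‖v‖ = ‖D x‖ := LinearIsometryEquiv.norm_map _ _
  have hv : ∀ z, D x z = inner ℝ v z := fun z => by
    simp [v]
  have hvm : m ≤ ‖v‖ := hvn ▸ h.grad
  have hv0 : 0 < ‖v‖ := hm.trans_le hvm
  refine ⟨‖v‖⁻¹ • v, ?_, ?_⟩
  · rw [norm_smul, norm_inv, norm_norm, inv_mul_cancel₀ hv0.ne']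
  intro z hzρ hz1 hez
  have hz0 : z ≠ 0 := by rintro rfl; simp at hez
  have hzp : 0 < ‖z‖ := norm_pos_iff.2 hz0
  set i := inner ℝ (‖v‖⁻¹ • v) z with hi
  have hDz : D x z = ‖v‖ * i := by
    rw [hv, hi, inner_smul_left]
    simp
    field_simp
  have t1 := h.taylor hρ hB z hzρ
  have t2 := h.taylor hρ hB (-z) (by rwa [norm_neg])
  rw [norm_neg, ← sub_eq_add_neg, map_neg] at t2
  have hu : |-(D x z)| ≤ B * ‖z‖ := by
    rw [abs_neg, ← Real.norm_eq_abs]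
    exact ((D x).le_opNorm z).trans
      (mul_le_mul_of_nonneg_right (h.bd x (mem_ball_self hρ)) (norm_nonneg _))
  have hJ := hC (w x - w (x + z)) (-(w x - w (x - z))) (-(D x z)) ‖z‖ hzp hz1
    (by rw [hDz]; exact neg_ne_zero.2 (mul_ne_zero hv0.ne' hez))
    (by rw [← abs_neg]; convert t1 using 2; ring)
    (by convert t2 using 2; ring) hu
  rw [Jp_neg, sub_neg_eq_add, abs_neg, hDz, abs_mul, abs_of_pos hv0,
    Real.mul_rpow hv0.le (abs_nonneg _)] at hJ
  have hvpow : ‖v‖ ^ (min p 2 - 2) ≤ m ^ (min p 2 - 2) :=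
    Real.rpow_le_rpow_of_nonpos hm hvm (by linarith [min_le_right p 2])
  have hJ0 := abs_nonneg (Jp p (w x - w (x + z)) + Jp p (w x - w (x - z)))
  unfold Sfun gfun
  rw [← hi, abs_mul, abs_of_pos (hKpos z hz0), abs_div, abs_two]
  have he : ‖z‖ ^ (-((N:ℝ) + s * p - (2 + p - min p 2))) =
      ‖z‖ ^ (2 + p - min p 2) * ‖z‖ ^ (-((N:ℝ) + s * p)) := by
    rw [← Real.rpow_add hzp]; congr 1; ring
  rw [he]
  calc _ ≤ (C * (‖z‖ ^ (2 + p - min p 2) * (m ^ (min p 2 - 2) * |i| ^ (min p 2 - 2)))) *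
        (Lam * ‖z‖ ^ (-((N : ℝ) + s * p))) := by
        apply mul_le_mul _ (hKub z hz0) (hKpos z hz0).le (by positivity)
        refine (half_le_self hJ0).trans (hJ.trans ?_)
        gcongr
    _ = _ := by ring

theorem Jp_diff_bd (p a b B : ℝ) (hp : 1 < p) (ha : |a| ≤ B) (hb : |b| ≤ B) :
    |Jp p (a - b)| ≤ (2 * B) ^ (p - 1) :=
  Jp_abs_le p _ _ hp ((abs_sub _ _).trans (by linarith))

theorem K_far (N : ℕ) (p s Lam r : ℝ) (hp : 1 < p) (hs : 0 < s) (hLam : 0 < Lam)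
    (hr : 0 < r) (K : Euc N → ℝ)
    (hKub : ∀ z : Euc N, z ≠ 0 → K z ≤ Lam * ‖z‖ ^ (-((N : ℝ) + s * p)))
    (z : Euc N) (hz : r ≤ ‖z‖) : K z ≤ Lam * r ^ (-((N : ℝ) + s * p)) := by
  refine (hKub z (norm_pos_iff.1 (hr.trans_le hz))).trans
    (mul_le_mul_of_nonneg_left ?_ hLam.le)
  apply Real.rpow_le_rpow_of_nonpos hr hz
  have : 0 < s * p := by positivity
  have : (0:ℝ) ≤ N := by positivity
  linarith

section
variable {N : ℕ} {w : Euc N → ℝ} {D : Euc N → (Euc N →L[ℝ] ℝ)}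
    {D2 : Euc N → (Euc N →L[ℝ] Euc N →L[ℝ] ℝ)} {x : Euc N} {ρ B m : ℝ}

theorem Good.meas1 (h : Good N w D D2 x ρ B m) (p : ℝ) (hp : 1 < p)
    (K : Euc N → ℝ) (hKm : Measurable K) :
    AEStronglyMeasurable (fun z => Jp p (w x - w (x + z)) * K z)
      (volume.restrict (ball (0 : Euc N) ρ)) := by
  refine AEStronglyMeasurable.mul ?_ hKm.aestronglyMeasurable
  apply ContinuousOn.aestronglyMeasurable _ measurableSet_ball
  refine (Jp_cont p hp).comp_continuousOn (continuousOn_const.sub ?_)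
  intro z hz
  have hc : ContinuousAt w (x + z) := (h.d1 (x + z) (by simpa using hz)).continuousAt
  exact (ContinuousAt.comp (f := fun z => x + z) hc (by fun_prop)).continuousWithinAt

theorem Good.meas2 (h : Good N w D D2 x ρ B m) (p : ℝ) (hp : 1 < p)
    (K : Euc N → ℝ) (hKm : Measurable K) :
    AEStronglyMeasurable (fun z => Jp p (w x - w (x - z)) * K z)
      (volume.restrict (ball (0 : Euc N) ρ)) := by
  refine AEStronglyMeasurable.mul ?_ hKm.aestronglyMeasurable
  apply ContinuousOn.aestronglyMeasurable _ measurableSet_ball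
  refine (Jp_cont p hp).comp_continuousOn (continuousOn_const.sub ?_)
  intro z hz
  have hc : ContinuousAt w (x - z) :=
    (h.d1 (x - z) (by simpa [dist_eq_norm] using hz)).continuousAt
  exact (ContinuousAt.comp (f := fun z => x - z) hc (by fun_prop)).continuousWithinAt

theorem Sfun_eq (p : ℝ) (K : Euc N → ℝ) (z : Euc N) : Sfun N p K w x z =
    (Jp p (w x - w (x + z)) * K z + Jp p (w x - w (x - z)) * K z) * (1 / 2) := by
  unfold Sfun; ring

theorem Good.int_far (h : Good N w D D2 x ρ B m) (hρ : 0 < ρ) (hB : 0 < B)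
    (p s Lam r : ℝ) (hp : 1 < p) (hs : 0 < s) (hLam : 0 < Lam) (hr : 0 < r)
    (K : Euc N → ℝ) (hKm : Measurable K) (hKpos : ∀ z : Euc N, z ≠ 0 → 0 < K z)
    (hKub : ∀ z : Euc N, z ≠ 0 → K z ≤ Lam * ‖z‖ ^ (-((N : ℝ) + s * p)))
    (A : Set (Euc N)) (hA : MeasurableSet A) (hAρ : A ⊆ ball 0 ρ) (hAr : ∀ z ∈ A, r ≤ ‖z‖) :
    IntegrableOn (fun z => Jp p (w x - w (x + z)) * K z) A ∧
    IntegrableOn (fun z => Jp p (w x - w (x - z)) * K z) A := by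
  have hfin : volume A < ⊤ := (measure_mono hAρ).trans_lt measure_ball_lt_top
  have hx := h.bw x (mem_ball_self hρ)
  constructor
  · refine IntegrableOn.of_bound hfin ((h.meas1 p hp K hKm).mono_set hAρ)
      ((2 * B) ^ (p - 1) * (Lam * r ^ (-((N : ℝ) + s * p)))) ?_
    rw [ae_restrict_iff' hA]
    refine Eventually.of_forall fun z hz => ?_
    have hz0 : z ≠ 0 := norm_pos_iff.1 (hr.trans_le (hAr z hz))
    rw [Real.norm_eq_abs, abs_mul, abs_of_pos (hKpos z hz0)]
    exact mul_le_mul (Jp_diff_bd p _ _ B hp hx (h.bw _ (by simpa using hAρ hz)))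
      (K_far N p s Lam r hp hs hLam hr K hKub z (hAr z hz)) (hKpos z hz0).le (by positivity)
  · refine IntegrableOn.of_bound hfin ((h.meas2 p hp K hKm).mono_set hAρ)
      ((2 * B) ^ (p - 1) * (Lam * r ^ (-((N : ℝ) + s * p)))) ?_
    rw [ae_restrict_iff' hA]
    refine Eventually.of_forall fun z hz => ?_
    have hz0 : z ≠ 0 := norm_pos_iff.1 (hr.trans_le (hAr z hz))
    rw [Real.norm_eq_abs, abs_mul, abs_of_pos (hKpos z hz0)]
    exact mul_le_mul (Jp_diff_bd p _ _ B hp hx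
        (h.bw _ (by simpa [dist_eq_norm] using hAρ hz)))
      (K_far N p s Lam r hp hs hLam hr K hKub z (hAr z hz)) (hKpos z hz0).le (by positivity)

theorem Good.pv_eq (h : Good N w D D2 x ρ B m) (hρ : 0 < ρ) (hB : 0 < B)
    (p s Lam : ℝ) (hp : 1 < p) (hs : 0 < s) (hLam : 0 < Lam)
    (K : Euc N → ℝ) (hKm : Measurable K) (hKpos : ∀ z : Euc N, z ≠ 0 → 0 < K z)
    (hKsymm : ∀ z : Euc N, z ≠ 0 → K (-z) = K z)
    (hKub : ∀ z : Euc N, z ≠ 0 → K z ≤ Lam * ‖z‖ ^ (-((N : ℝ) + s * p)))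
    (r : ℝ) (hr : 0 < r) :
    pvIntegral N p ρ K w x r = ∫ z in {z : Euc N | r < ‖z‖ ∧ ‖z‖ < ρ}, Sfun N p K w x z := by
  set A := {z : Euc N | r < ‖z‖ ∧ ‖z‖ < ρ} with hAdef
  have hA : MeasurableSet A :=
    (measurableSet_lt measurable_const measurable_norm).inter
      (measurableSet_lt measurable_norm measurable_const)
  have hA0 : ∀ z ∈ A, z ≠ 0 := fun z hz => norm_pos_iff.1 (hr.trans hz.1)
  obtain ⟨i1, i2⟩ := h.int_far hρ hB p s Lam r hp hs hLam hr K hKm hKpos hKub A hA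
    (fun z hz => by simpa using hz.2) (fun z hz => hz.1.le)
  simp_rw [Sfun_eq]
  rw [integral_mul_const, integral_add i1 i2]
  have e1 : pvIntegral N p ρ K w x r = ∫ z in A, Jp p (w x - w (x + z)) * K z := by
    unfold pvIntegral
    have hpre : A = (fun z => x + z) ⁻¹' {y : Euc N | r < dist y x ∧ dist y x < ρ} := by
      ext z; simp [hAdef, dist_eq_norm]
    have := (measurePreserving_add_left (volume : Measure (Euc N)) x).setIntegral_preimage_emb
      (measurableEmbedding_addLeft x) (fun y => Jp p (w x - w y) * K (x - y))
      {y : Euc N | r < dist y x ∧ dist y x < ρ}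
    rw [← hpre] at this
    rw [← this]
    apply setIntegral_congr_fun hA
    intro z hz
    simp only
    rw [show x - (x + z) = -z by abel, hKsymm z (hA0 z hz)]
  have e2 : ∫ z in A, Jp p (w x - w (x - z)) * K z = ∫ z in A, Jp p (w x - w (x + z)) * K z := by
    have hpre : A = (fun z => -z) ⁻¹' A := by
      ext z; simp [hAdef]
    have := (Measure.measurePreserving_neg (volume : Measure (Euc N))).setIntegral_preimage_emb
      (MeasurableEquiv.neg (Euc N)).measurableEmbedding
      (fun z => Jp p (w x - w (x + z)) * K z) A
    rw [← this]
    change _ = ∫ z in (fun z => -z) ⁻¹' A, _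
    rw [← hpre]
    apply setIntegral_congr_fun hA
    intro z hz
    simp only
    rw [hKsymm z (hA0 z hz), ← sub_eq_add_neg]
  rw [e1, e2]; ring

theorem pv_of_int (p : ℝ) (K : Euc N → ℝ)
    (hi : IntegrableOn (Sfun N p K w x) (ball 0 ρ))
    (hpv : ∀ r, 0 < r → pvIntegral N p ρ K w x r =
      ∫ z in {z : Euc N | r < ‖z‖ ∧ ‖z‖ < ρ}, Sfun N p K w x z) :
    HasPV N p ρ K w x (∫ z in ball 0 ρ, Sfun N p K w x z) := by
  unfold HasPV
  have hT : Tendsto (fun r : ℝ => ∫ z in ball 0 ρ,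
      ({z : Euc N | r < ‖z‖}).indicator (Sfun N p K w x) z) (𝓝[>] 0)
      (𝓝 (∫ z in ball 0 ρ, Sfun N p K w x z)) := by
    apply tendsto_integral_filter_of_dominated_convergence (fun z => ‖Sfun N p K w x z‖)
    · refine Eventually.of_forall fun r => ?_
      exact hi.aestronglyMeasurable.indicator (measurableSet_lt measurable_const measurable_norm)
    · refine Eventually.of_forall fun r => Eventually.of_forall fun z => ?_
      exact norm_indicator_le_norm_self _ _
    · exact hi.norm
    · refine Eventually.of_forall fun z => ?_
      rcases eq_or_ne z 0 with rfl | hz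
      · have h0 : Sfun N p K w x 0 = 0 := by simp [Sfun, Jp]
        rw [h0]
        refine tendsto_const_nhds.congr fun r => ?_
        by_cases hr : (0 : Euc N) ∈ {z : Euc N | r < ‖z‖}
        · rw [indicator_of_mem hr, h0]
        · rw [indicator_of_notMem hr]
      · refine tendsto_const_nhds.congr' ?_
        have : ∀ᶠ r in 𝓝[>] (0:ℝ), r < ‖z‖ :=
          nhdsWithin_le_nhds (gt_mem_nhds (norm_pos_iff.2 hz))
        filter_upwards [this] with r hr
        rw [indicator_of_mem (show z ∈ {z : Euc N | r < ‖z‖} from hr)]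
  refine hT.congr' ?_
  filter_upwards [self_mem_nhdsWithin] with r hr
  rw [hpv r hr, setIntegral_indicator (measurableSet_lt measurable_const measurable_norm)]
  congr 2
  ext z
  simp [and_comm]
end

theorem norm_smul_le' {F : Type*} [NormedAddCommGroup F] [NormedSpace ℝ F] (ε : ℝ) (a : F) :
    ‖ε • a‖ ≤ |ε| * ‖a‖ := by rw [norm_smul, Real.norm_eq_abs]

theorem hess_smul_le (N : ℕ) (ε : ℝ) (a : Euc N →L[ℝ] Euc N →L[ℝ] ℝ) :
    ‖ε • a‖ ≤ |ε| * ‖a‖ := norm_smul_le' (F := Euc N →L[ℝ] Euc N →L[ℝ] ℝ) ε a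

theorem eta_bound (N : ℕ) (η : Euc N → ℝ → ℝ) (Dη : Euc N → ℝ → (Euc N →L[ℝ] ℝ))
    (D2η : Euc N → ℝ → (Euc N →L[ℝ] Euc N →L[ℝ] ℝ)) (ηt : Euc N → ℝ → ℝ)
    (hηreg : C2xC1t N univ univ η Dη D2η ηt)
    (hηsupp : HasCompactSupport (fun q : Euc N × ℝ => η q.1 q.2)) :
    ∃ B : ℝ, 0 < B ∧ ∀ x t, ‖Dη x t‖ ≤ B ∧ ‖D2η x t‖ ≤ B ∧ |ηt x t| ≤ B := by
  obtain ⟨-, h1, c1, h2, c2, h3, c3⟩ := hηreg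
  set T := tsupport (fun q : Euc N × ℝ => η q.1 q.2) with hT
  have hTc : IsCompact T := hηsupp
  have hopen : IsOpen Tᶜ := (isClosed_tsupport _).isOpen_compl
  have hz : ∀ q ∈ Tᶜ, η q.1 q.2 = 0 := fun q hq =>
    image_eq_zero_of_notMem_tsupport (f := fun q : Euc N × ℝ => η q.1 q.2) hq
  have ev1 : ∀ x t, (x, t) ∈ Tᶜ → ∀ᶠ y in 𝓝 x, (y, t) ∈ Tᶜ := fun x t hxt =>
    (Continuous.prodMk_left t).continuousAt.eventually (hopen.mem_nhds hxt)
  have ev2 : ∀ x t, (x, t) ∈ Tᶜ → ∀ᶠ τ in 𝓝 t, (x, τ) ∈ Tᶜ := fun x t hxt =>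
    (Continuous.prodMk_right x).continuousAt.eventually (hopen.mem_nhds hxt)
  have z1 : ∀ x t, (x, t) ∈ Tᶜ → Dη x t = 0 := by
    intro x t hxt
    have h := h1 x (mem_univ _) t (mem_univ _)
    have h0 : HasFDerivAt (fun y => η y t) (0 : Euc N →L[ℝ] ℝ) x :=
      (hasFDerivAt_const (0:ℝ) x).congr_of_eventuallyEq
        ((ev1 x t hxt).mono fun y hy => hz _ hy)
    exact h.unique h0
  have z2 : ∀ x t, (x, t) ∈ Tᶜ → D2η x t = 0 := by
    intro x t hxt
    have h := h2 x (mem_univ _) t (mem_univ _)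
    have h0 : HasFDerivAt (fun y => Dη y t) (0 : Euc N →L[ℝ] Euc N →L[ℝ] ℝ) x :=
      (hasFDerivAt_const (0 : Euc N →L[ℝ] ℝ) x).congr_of_eventuallyEq
        ((ev1 x t hxt).mono fun y hy => z1 _ _ hy)
    exact h.unique h0
  have z3 : ∀ x t, (x, t) ∈ Tᶜ → ηt x t = 0 := by
    intro x t hxt
    have h := (h3 x (mem_univ _) t (mem_univ _)).hasDerivAt univ_mem
    have h0 : HasDerivAt (fun τ => η x τ) 0 t :=
      (hasDerivAt_const t (0:ℝ)).congr_of_eventuallyEq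
        ((ev2 x t hxt).mono fun y hy => hz _ hy)
    exact h.unique h0
  obtain ⟨B1, hB1⟩ := hTc.exists_bound_of_continuousOn (c1.mono (by simp))
  obtain ⟨B2, hB2⟩ := hTc.exists_bound_of_continuousOn
    (E := Euc N →L[ℝ] Euc N →L[ℝ] ℝ) (c2.mono (by simp))
  obtain ⟨B3, hB3⟩ := hTc.exists_bound_of_continuousOn (c3.mono (by simp))
  have a1 := le_abs_self B1
  have a2 := le_abs_self B2
  have a3 := le_abs_self B3
  have n1 := abs_nonneg B1
  have n2 := abs_nonneg B2
  have n3 := abs_nonneg B3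
  refine ⟨|B1| + |B2| + |B3| + 1, by positivity, ?_⟩
  intro x t
  by_cases hxt : (x, t) ∈ T
  · have b1 := hB1 _ hxt
    have b2 := hB2 _ hxt
    have b3 := hB3 _ hxt
    rw [Real.norm_eq_abs] at b3
    simp only at b1 b2 b3
    exact ⟨by linarith, by linarith, by linarith⟩
  · rw [z1 x t hxt, z2 x t hxt, z3 x t hxt]
    have hh : ‖(0 : Euc N →L[ℝ] Euc N →L[ℝ] ℝ)‖ = 0 :=
      norm_zero (E := Euc N →L[ℝ] Euc N →L[ℝ] ℝ)
    rw [hh]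
    simp only [norm_zero, abs_zero]
    refine ⟨?_, ?_, ?_⟩ <;> positivity

theorem S_int {N : ℕ} {w : Euc N → ℝ} {D : Euc N → (Euc N →L[ℝ] ℝ)}
    {D2 : Euc N → (Euc N →L[ℝ] Euc N →L[ℝ] ℝ)} {x : Euc N} {ρ B m : ℝ}
    (h : Good N w D D2 x ρ B m) (i0 : Fin N) (hρ : 0 < ρ) (hB : 0 < B)
    (p s Lam : ℝ) (hp : 1 < p) (hs : 0 < s) (hLam : 0 < Lam)
    (K : Euc N → ℝ) (hKm : Measurable K) (hKpos : ∀ z : Euc N, z ≠ 0 → 0 < K z)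
    (hKub : ∀ z : Euc N, z ≠ 0 → K z ≤ Lam * ‖z‖ ^ (-((N : ℝ) + s * p)))
    (q β C : ℝ)
    (hg : IntegrableOn (fun z : Euc N => ‖z‖ ^ (-β) * |z i0| ^ (q - 2)) (ball 0 1))
    (e : Euc N) (he : ‖e‖ = 1)
    (hS : ∀ z : Euc N, ‖z‖ < ρ → ‖z‖ ≤ 1 → inner ℝ e z ≠ 0 →
        |Sfun N p K w x z| ≤ C * gfun N q β e z) :
    IntegrableOn (Sfun N p K w x) (ball 0 ρ) ∧
    ∀ r, r ≤ 1 → r ≤ ρ → |∫ z in ball 0 r, Sfun N p K w x z| ≤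
      C * ∫ z in ball 0 r, ‖z‖ ^ (-β) * |(z : Euc N) i0| ^ (q - 2) := by
  have he0 : e ≠ 0 := by rintro rfl; simp at he
  have hae := ae_inner_ne N e he0
  have hmeas : AEStronglyMeasurable (Sfun N p K w x) (volume.restrict (ball (0 : Euc N) ρ)) := by
    have := ((h.meas1 p hp K hKm).add (h.meas2 p hp K hKm)).mul_const (1 / 2 : ℝ)
    refine this.congr (Eventually.of_forall fun z => ?_)
    rw [Sfun_eq]; rfl
  have hbd : ∀ r, r ≤ 1 → r ≤ ρ → ∀ᵐ z ∂(volume.restrict (ball (0 : Euc N) r)),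
      ‖Sfun N p K w x z‖ ≤ C * gfun N q β e z := by
    intro r hr1 hrρ
    rw [ae_restrict_iff' measurableSet_ball]
    filter_upwards [hae] with z hz hzr
    have : ‖z‖ < r := by simpa using hzr
    exact hS z (this.trans_le hrρ) (this.le.trans hr1) hz
  have hgr : ∀ r, r ≤ 1 → IntegrableOn (gfun N q β e) (ball 0 r) ∧
    ∫ z in ball 0 r, gfun N q β e z = ∫ z in ball 0 r, ‖z‖ ^ (-β) * |(z : Euc N) i0| ^ (q - 2) :=
    fun r hr => gfun_rot N i0 q β e he r (hg.mono_set (ball_subset_ball hr))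
  constructor
  · have hr0 : 0 < min ρ 1 := lt_min hρ one_pos
    have i1 : IntegrableOn (Sfun N p K w x) (ball 0 (min ρ 1)) :=
      Integrable.mono' ((hgr _ (min_le_right _ _)).1.const_mul C)
        (hmeas.mono_set (ball_subset_ball (min_le_left _ _)))
        (hbd _ (min_le_right _ _) (min_le_left _ _))
    obtain ⟨j1, j2⟩ := h.int_far hρ hB p s Lam (min ρ 1) hp hs hLam hr0 K hKm hKpos hKub
      (ball 0 ρ \ ball 0 (min ρ 1)) (measurableSet_ball.diff measurableSet_ball) sdiff_subset
      (fun z hz => by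
        have := hz.2
        rw [mem_ball_zero_iff, not_lt] at this
        exact this)
    have i2 : IntegrableOn (Sfun N p K w x) (ball 0 ρ \ ball 0 (min ρ 1)) := by
      refine ((j1.add j2).mul_const (1 / 2 : ℝ)).congr (Eventually.of_forall fun z => ?_)
      simp only [Pi.add_apply]
      rw [Sfun_eq]
    have := i1.union i2
    rwa [union_sdiff_cancel (ball_subset_ball (min_le_left _ _))] at this
  · intro r hr1 hrρ
    rw [← (hgr r hr1).2, ← integral_const_mul]
    exact norm_integral_le_of_norm_le ((hgr r hr1).1.const_mul C) (hbd r hr1 hrρ)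

theorem S_diff_far {N : ℕ} (p s Lam r κ : ℝ) (hp : 1 < p) (hs : 0 < s) (hLam : 0 < Lam)
    (hr : 0 < r) (K : Euc N → ℝ) (hKpos : ∀ z : Euc N, z ≠ 0 → 0 < K z)
    (hKub : ∀ z : Euc N, z ≠ 0 → K z ≤ Lam * ‖z‖ ^ (-((N : ℝ) + s * p)))
    (w w' : Euc N → ℝ) (x z : Euc N) (hz : r ≤ ‖z‖)
    (h1 : |Jp p (w x - w (x + z)) - Jp p (w' x - w' (x + z))| ≤ κ)
    (h2 : |Jp p (w x - w (x - z)) - Jp p (w' x - w' (x - z))| ≤ κ) :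
    |Sfun N p K w x z - Sfun N p K w' x z| ≤ κ * (Lam * r ^ (-((N : ℝ) + s * p))) := by
  have hz0 : z ≠ 0 := norm_pos_iff.1 (hr.trans_le hz)
  have hκ : 0 ≤ κ := (abs_nonneg _).trans h1
  have e : Sfun N p K w x z - Sfun N p K w' x z =
      ((Jp p (w x - w (x + z)) - Jp p (w' x - w' (x + z))) +
        (Jp p (w x - w (x - z)) - Jp p (w' x - w' (x - z)))) / 2 * K z := by
    unfold Sfun; ring
  rw [e, abs_mul, abs_of_pos (hKpos z hz0), abs_div, abs_two]
  refine mul_le_mul ?_ (K_far N p s Lam r hp hs hLam hr K hKub z hz) (hKpos z hz0).le hκ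
  rw [div_le_iff₀ two_pos]
  exact (abs_add_le _ _).trans (by linarith)

theorem main_core
    (N : ℕ) (hN : 1 ≤ N) (p s Lam : ℝ)
    (hp : 1 < p) (hs : s ∈ Ioo (0 : ℝ) 1) (hLam : 0 < Lam)
    (K : Euc N → ℝ)
    (hKm : Measurable K) (hKpos : ∀ z : Euc N, z ≠ 0 → 0 < K z)
    (hKsymm : ∀ z : Euc N, z ≠ 0 → K (-z) = K z)
    (hKub : ∀ z : Euc N, z ≠ 0 → K z ≤ Lam * ‖z‖ ^ (-((N : ℝ) + s * p)))
    (ρ B m δ : ℝ) (hρ : 0 < ρ) (hB : 0 < B) (hm : 0 < m) (hδ : 0 < δ) :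
    ∃ ε₁ : ℝ, 0 < ε₁ ∧ ∀ w D D2 w' D' D2' x, Good N w D D2 x ρ B m →
      Good N w' D' D2' x ρ B m →
      (∀ y ∈ ball x ρ, |(w x - w y) - (w' x - w' y)| < ε₁) →
      ∀ l, HasPV N p ρ K w x l → ∃ l', HasPV N p ρ K w' x l' ∧ l - δ ≤ l' := by
  let i0 : Fin N := ⟨0, hN⟩
  obtain ⟨C, hC0, hC⟩ := S_near N p s Lam ρ B m hp hLam hρ hB hm K hKpos hKub
  set q := min p 2 with hq
  set β := (N:ℝ) + s * p - (2 + p - q) with hβ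
  have hg := g_integrable N i0 q β (lt_min hp one_lt_two) (min_le_right _ _) (by
    rw [hβ]
    have : s * p < p := by nlinarith [hs.2]
    linarith)
  obtain ⟨r, hr0, hr1, hrρ, hrint⟩ := g_small N i0 _ hg (δ / (4 * (C + 1))) (by positivity) ρ hρ
  set M := Lam * r ^ (-((N : ℝ) + s * p)) with hM
  have hM0 : 0 < M := by positivity
  set v := (volume : Measure (Euc N)).real (ball 0 ρ \ ball 0 r) with hv
  have hv0 : 0 ≤ v := measureReal_nonneg
  set κ := δ / (2 * (M * v + 1)) with hκ
  have hκ0 : 0 < κ := by positivity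
  have huc := (isCompact_Icc (a := -(2 * B)) (b := 2 * B)).uniformContinuousOn_of_continuous
    (Jp_cont p hp).continuousOn
  rw [Metric.uniformContinuousOn_iff] at huc
  obtain ⟨ε₁, hε₁, huc⟩ := huc κ hκ0
  refine ⟨ε₁, hε₁, ?_⟩
  intro w D D2 w' D' D2' x h h' hclose l hl
  obtain ⟨e, he, hS⟩ := hC w D D2 x h
  obtain ⟨e', he', hS'⟩ := hC w' D' D2' x h'
  obtain ⟨hi, hib⟩ := S_int h i0 hρ hB p s Lam hp hs.1 hLam K hKm hKpos hKub q β C hg e he hS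
  obtain ⟨hi', hib'⟩ := S_int h' i0 hρ hB p s Lam hp hs.1 hLam K hKm hKpos hKub q β C hg e' he' hS'
  have hpv := pv_of_int p K hi (fun r hr => h.pv_eq hρ hB p s Lam hp hs.1 hLam K hKm hKpos
    hKsymm hKub r hr)
  have hpv' := pv_of_int p K hi' (fun r hr => h'.pv_eq hρ hB p s Lam hp hs.1 hLam K hKm hKpos
    hKsymm hKub r hr)
  have hll := tendsto_nhds_unique hl hpv
  refine ⟨_, hpv', ?_⟩
  rw [hll]
  have hsub : ball (0 : Euc N) r ⊆ ball 0 ρ := ball_subset_ball hrρ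
  have hsplit : ∀ f : Euc N → ℝ, IntegrableOn f (ball 0 ρ) →
      ∫ z in ball 0 ρ, f z = (∫ z in ball 0 r, f z) + ∫ z in ball 0 ρ \ ball 0 r, f z := by
    intro f hf
    rw [← setIntegral_union disjoint_sdiff_right (measurableSet_ball.diff measurableSet_ball)
      (hf.mono_set hsub) (hf.mono_set sdiff_subset), union_sdiff_cancel hsub]
  rw [hsplit _ hi, hsplit _ hi']
  have b1 := hib r hr1 hrρ
  have b2 := hib' r hr1 hrρ
  have b3 : C * ∫ z in ball 0 r, ‖z‖ ^ (-β) * |(z : Euc N) i0| ^ (q - 2) ≤ δ / 4 := by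
    calc _ ≤ C * (δ / (4 * (C + 1))) := mul_le_mul_of_nonneg_left hrint.le hC0
      _ ≤ (C + 1) * (δ / (4 * (C + 1))) :=
        mul_le_mul_of_nonneg_right (by linarith) (by positivity)
      _ = δ / 4 := by field_simp
  have hJ : ∀ y ∈ ball x ρ, |Jp p (w x - w y) - Jp p (w' x - w' y)| ≤ κ := by
    intro y hy
    have hx := mem_ball_self hρ (x := x)
    have A : ∀ a b : ℝ, |a| ≤ B → |b| ≤ B → a - b ∈ Icc (-(2 * B)) (2 * B) := by
      intro a b ha hb
      rw [abs_le] at ha hb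
      exact ⟨by linarith, by linarith⟩
    have := huc _ (A _ _ (h.bw x hx) (h.bw y hy)) _ (A _ _ (h'.bw x hx) (h'.bw y hy))
      (by rw [Real.dist_eq]; exact hclose y hy)
    rw [Real.dist_eq] at this
    exact this.le
  have b4 : |∫ z in ball 0 ρ \ ball 0 r, (Sfun N p K w x z - Sfun N p K w' x z)| ≤ δ / 2 := by
    have := norm_setIntegral_le_of_norm_le_const (μ := (volume : Measure (Euc N)))
      (s := ball 0 ρ \ ball 0 r) (C := κ * M)
      (f := fun z => Sfun N p K w x z - Sfun N p K w' x z)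
      ((measure_mono sdiff_subset).trans_lt measure_ball_lt_top)
      (fun z hz => by
        have hzr : r ≤ ‖z‖ := by
          have := hz.2
          rw [mem_ball_zero_iff, not_lt] at this
          exact this
        have hzρ : ‖z‖ < ρ := by simpa using hz.1
        exact S_diff_far p s Lam r κ hp hs.1 hLam hr0 K hKpos hKub w w' x z hzr
          (hJ _ (by simpa using hzρ)) (hJ _ (by simpa [dist_eq_norm] using hzρ)))
    refine this.trans ?_
    rw [← hv, hκ]
    have : δ / (2 * (M * v + 1)) * M * v = δ / 2 * ((M * v) / (M * v + 1)) := by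
      field_simp
    rw [this]
    have : (M * v) / (M * v + 1) ≤ 1 := (div_le_one (by positivity)).2 (by linarith)
    nlinarith
  rw [integral_sub (hi.mono_set sdiff_subset) (hi'.mono_set sdiff_subset)] at b4
  have c1 := abs_le.1 b1
  have c2 := abs_le.1 b2
  have c4 := abs_le.1 b4
  linarith [c1.2, c2.1, c4.2]

/-- a smooth strict supersolution of the truncated equation remains a strict
supersolution under small perturbations `φ - εη`. -/
theorem perturbation_stays_strict_supersolution
    (N : ℕ) (hN : 1 ≤ N) (p s Lam : ℝ)
    (hp : 1 < p) (hs : s ∈ Ioo (0 : ℝ) 1) (hLam : 0 < Lam)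
    (K : Euc N → ℝ)
    (hKm : Measurable K) (hKpos : ∀ z : Euc N, z ≠ 0 → 0 < K z)
    (hKsymm : ∀ z : Euc N, z ≠ 0 → K (-z) = K z)
    (hKub : ∀ z : Euc N, z ≠ 0 → K z ≤ Lam * ‖z‖ ^ (-((N : ℝ) + s * p)))
    (Ω U V 𝒦 : Set (Euc N)) (I : Set ℝ)
    (hΩ : IsOpen Ω) (hV : IsOpen V) (h𝒦 : IsCompact 𝒦) (hV𝒦 : V ⊆ 𝒦)
    (hI : Bornology.IsBounded I) (hIc : I.OrdConnected)
    (hU : IsOpen U) (h𝒦U : 𝒦 ⊆ U) (hUc : IsCompact (closure U)) (hUΩ : closure U ⊆ Ω)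
    (ρ : ℝ) (hρ : 0 < ρ) (hρU : ∀ x ∈ 𝒦, ball x ρ ⊆ U)
    (φ : Euc N → ℝ → ℝ) (Dφ : Euc N → ℝ → (Euc N →L[ℝ] ℝ))
    (D2φ : Euc N → ℝ → (Euc N →L[ℝ] Euc N →L[ℝ] ℝ)) (φt : Euc N → ℝ → ℝ)
    (hreg : C2xC1t N U I φ Dφ D2φ φt)
    (hbd : ∃ B : ℝ, ∀ x ∈ U, ∀ t ∈ I,
      |φ x t| ≤ B ∧ ‖Dφ x t‖ ≤ B ∧ ‖D2φ x t‖ ≤ B ∧ |φt x t| ≤ B)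
    (m : ℝ) (hm : 0 < m) (hgrad : ∀ x ∈ U, ∀ t ∈ I, m ≤ ‖Dφ x t‖)
    (δ : ℝ) (hδ : 0 < δ)
    (hsuper : ∀ x ∈ V, ∀ t ∈ I, ∃ l : ℝ,
      HasPV N p ρ K (fun y => φ y t) x l ∧ δ ≤ φt x t + l)
    (η : Euc N → ℝ → ℝ) (Dη : Euc N → ℝ → (Euc N →L[ℝ] ℝ))
    (D2η : Euc N → ℝ → (Euc N →L[ℝ] Euc N →L[ℝ] ℝ)) (ηt : Euc N → ℝ → ℝ)
    (hηreg : C2xC1t N univ univ η Dη D2η ηt)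
    (hηsupp : HasCompactSupport (fun q : Euc N × ℝ => η q.1 q.2))
    (hηsupp' : tsupport (fun q : Euc N × ℝ => η q.1 q.2) ⊆ V ×ˢ I)
    (hη01 : ∀ x t, 0 ≤ η x t ∧ η x t ≤ 1) :
    ∃ ε₀ : ℝ, 0 < ε₀ ∧ ε₀ < 1 ∧
      ∀ ε : ℝ, 0 < ε → ε < ε₀ →
        ∀ x ∈ V, ∀ t ∈ I, ∃ l : ℝ,
          HasPV N p ρ K (fun y => φ y t - ε * η y t) x l ∧
          δ / 2 ≤ (φt x t - ε * ηt x t) + l := by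
  obtain ⟨B, hB⟩ := hbd
  obtain ⟨Be, hBe0, hBe⟩ := eta_bound N η Dη D2η ηt hηreg hηsupp
  obtain ⟨-, f1, -, f2, -, -, -⟩ := hreg
  obtain ⟨-, g1, -, g2, -, -, -⟩ := hηreg
  have hBa := le_abs_self B
  have hBn := abs_nonneg B
  obtain ⟨ε₁, hε₁, hcore⟩ := main_core N hN p s Lam hp hs hLam K hKm hKpos hKsymm hKub ρ
    (|B| + Be + 1) (m / 2) (δ / 4) hρ (by positivity) (by positivity) (by positivity)
  refine ⟨min (min ε₁ (1 / 2)) (min (m / (2 * Be)) (δ / (4 * Be))),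
    by positivity,
    lt_of_le_of_lt ((min_le_left _ _).trans (min_le_right _ _)) (by norm_num), ?_⟩
  intro ε hε0 hε x hx t ht
  rw [lt_min_iff, lt_min_iff, lt_min_iff] at hε
  obtain ⟨⟨k1, k2⟩, k3, k4⟩ := hε
  rw [lt_div_iff₀ (by positivity)] at k3 k4
  have hUx : ball x ρ ⊆ U := hρU x (hV𝒦 hx)
  have hxU : x ∈ U := h𝒦U (hV𝒦 hx)
  have hεBe : ε * Be ≤ Be := by nlinarith
  have G : Good N (fun y => φ y t) (fun y => Dφ y t) (fun y => D2φ y t) x ρ (|B| + Be + 1)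
      (m / 2) := by
    refine ⟨fun y hy => f1 y (hUx hy) t ht, fun y hy => f2 y (hUx hy) t ht, ?_, ?_, ?_, ?_⟩
    · intro y hy; have := (hB y (hUx hy) t ht).1; linarith
    · intro y hy; have := (hB y (hUx hy) t ht).2.1; linarith
    · intro y hy; have := (hB y (hUx hy) t ht).2.2.1; linarith
    · have := hgrad x hxU t ht; linarith
  have G' : Good N (fun y => φ y t - ε * η y t) (fun y => Dφ y t - ε • Dη y t)
      (fun y => D2φ y t - ε • D2η y t) x ρ (|B| + Be + 1) (m / 2) := by
    refine ⟨fun y hy => (f1 y (hUx hy) t ht).sub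
        ((g1 y (mem_univ _) t (mem_univ _)).const_mul ε),
      fun y hy => (f2 y (hUx hy) t ht).sub
        ((g2 y (mem_univ _) t (mem_univ _)).const_smul ε), ?_, ?_, ?_, ?_⟩
    · intro y hy
      have h1 := (hB y (hUx hy) t ht).1
      have h2 := hη01 y t
      have h3 : |ε * η y t| ≤ 1 := by
        rw [abs_of_nonneg (mul_nonneg hε0.le h2.1)]
        nlinarith [h2.1, h2.2]
      exact (abs_sub _ _).trans (by linarith)
    · intro y hy
      have h1 := (hB y (hUx hy) t ht).2.1
      have h2 := (hBe y t).1
      have h3 : ‖ε • Dη y t‖ ≤ Be := by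
        rw [norm_smul, Real.norm_eq_abs, abs_of_pos hε0]
        exact (mul_le_mul_of_nonneg_left h2 hε0.le).trans hεBe
      exact (norm_sub_le _ _).trans (by linarith)
    · intro y hy
      have h1 := (hB y (hUx hy) t ht).2.2.1
      have h2 := (hBe y t).2.1
      have h3 : ‖ε • D2η y t‖ ≤ Be := by
        refine (hess_smul_le N ε _).trans ?_
        rw [abs_of_pos hε0]
        exact (mul_le_mul_of_nonneg_left h2 hε0.le).trans hεBe
      exact (norm_sub_le (E := Euc N →L[ℝ] Euc N →L[ℝ] ℝ) (D2φ y t) (ε • D2η y t)).trans (by linarith)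
    · have h1 := hgrad x hxU t ht
      have h2 := (hBe x t).1
      have h3 : ‖ε • Dη x t‖ ≤ ε * Be := by
        rw [norm_smul, Real.norm_eq_abs, abs_of_pos hε0]
        exact mul_le_mul_of_nonneg_left h2 hε0.le
      have h4 := norm_sub_norm_le (Dφ x t) (ε • Dη x t)
      linarith
  obtain ⟨l, hl, hle⟩ := hsuper x hx t ht
  obtain ⟨l', hl', hle'⟩ := hcore _ _ _ _ _ _ x G G' (by
    intro y hy
    have h1 := hη01 x t
    have h2 := hη01 y t
    have e : (φ x t - φ y t) - ((φ x t - ε * η x t) - (φ y t - ε * η y t)) =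
      ε * (η x t - η y t) := by ring
    simp only [e]
    rw [abs_mul, abs_of_pos hε0]
    have : |η x t - η y t| ≤ 1 := abs_le.2 ⟨by linarith [h1.1, h2.2], by linarith [h1.2, h2.1]⟩
    nlinarith) l hl
  refine ⟨l', hl', ?_⟩
  have h5 := (hBe x t).2.2
  have h6 : ε * ηt x t ≤ ε * Be := mul_le_mul_of_nonneg_left ((le_abs_self _).trans h5) hε0.le
  linarith
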